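/- Let c:A be a sound approximation of dynamic policy D. If ⊢{c}Γ is derived by the dependency type system and the equivalence relation ≡_{Γ(a_p)} is coarser than A(a_p) for all channel–program-point pairs a_p, then c is two-run PI secure for D on all channels and for all initial stores. -/

import Mathlib

/-- Program variables. -/
abbrev PVar := String
/-- Channels. -/
abbrev Chan := String
/-- Program points. -/
abbrev PPoint := String
/-- Values. -/
abbrev Val := ℤ
/-- Stores map program variables to values. -/
abbrev Store := PVar → Val

/-- Expressions: integer constants or variables. -/
inductive Expr where
  | const : Val → Expr
  | var : PVar → Expr
deriving DecidableEq

def Expr.eval : Expr → Store → Val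
  | .const v, _ => v
  | .var x, σ => σ x

def Expr.fv : Expr → Set PVar
  | .const _ => ∅
  | .var x => {x}

/-- Commands of the while-language with annotated outputs. -/
inductive Cmd where
  | skip : Cmd
  | seq : Cmd → Cmd → Cmd
  | assign : PVar → Expr → Cmd
  | ite : Expr → Cmd → Cmd → Cmd
  | while : Expr → Cmd → Cmd
  | out : Expr → Chan → PPoint → Cmd
deriving DecidableEq

/-- Step labels: silent, or an output (channel, value, program point). -/
inductive Label where
  | silent : Label
  | out : Chan → Val → PPoint → Label
deriving DecidableEq

abbrev Config := Cmd × Store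

/-- Small-step semantics. -/
inductive Step : Config → Label → Config → Prop where
  | skipSeq : ∀ (c : Cmd) (σ : Store), Step (.seq .skip c, σ) .silent (c, σ)
  | seq : ∀ {c₁ : Cmd} {σ : Store} {α : Label} {c₁' : Cmd} {σ' : Store} (c₂ : Cmd),
      Step (c₁, σ) α (c₁', σ') → Step (.seq c₁ c₂, σ) α (.seq c₁' c₂, σ')
  | assign : ∀ (x : PVar) (e : Expr) (σ : Store),
      Step (.assign x e, σ) .silent (.skip, Function.update σ x (e.eval σ))
  | out : ∀ (e : Expr) (a : Chan) (p : PPoint) (σ : Store),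
      Step (.out e a p, σ) (.out a (e.eval σ) p) (.skip, σ)
  | whileStep : ∀ (e : Expr) (c : Cmd) (σ : Store),
      Step (.while e c, σ) .silent (.ite e (.seq c (.while e c)) .skip, σ)
  | iteTrue : ∀ {e : Expr} {σ : Store} (c₁ c₂ : Cmd),
      e.eval σ ≠ 0 → Step (.ite e c₁ c₂, σ) .silent (c₁, σ)
  | iteFalse : ∀ {e : Expr} {σ : Store} (c₁ c₂ : Cmd),
      e.eval σ = 0 → Step (.ite e c₁ c₂, σ) .silent (c₂, σ)

/-- Prepend a label to a list of (output) labels, dropping silent labels. -/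
def Label.consTo : Label → List Label → List Label
  | .silent, ls => ls
  | l, ls => l :: ls

/-- `Steps cfg ls n cfg'`: `n` evaluation steps from `cfg` to `cfg'`, producing
the list `ls` of output labels (silent steps contribute nothing). -/
inductive Steps : Config → List Label → ℕ → Config → Prop where
  | refl : ∀ cfg, Steps cfg [] 0 cfg
  | step : ∀ {cfg : Config} {α : Label} {cfg' : Config} {ls : List Label} {n : ℕ} {cfg'' : Config},
      Step cfg α cfg' → Steps cfg' ls n cfg'' → Steps cfg (α.consTo ls) (n+1) cfg''

/-- Projection of a label list to the values output on channel `a`. -/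
def projA (a : Chan) (ls : List Label) : List Val :=
  ls.filterMap fun l => match l with
    | .silent => none
    | .out b v _ => if b = a then some v else none

/-- `⟨c,σ⟩ ⇒t_a,n ⟨c',σ'⟩`: n steps producing trace `t` of values on channel `a`. -/
def ProjSteps (cfg : Config) (a : Chan) (t : List Val) (n : ℕ) (cfg' : Config) : Prop :=
  ∃ ls, Steps cfg ls n cfg' ∧ projA a ls = t

/-- `⟨c,σ⟩ ⇒t_a`: the run of `c` from `σ` produces trace `t` on channel `a`. -/
def Produces (c : Cmd) (σ : Store) (a : Chan) (t : List Val) : Prop :=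
  ∃ n cfg', ProjSteps (c, σ) a t n cfg'

/-- A forgetful attacker: a deterministic automaton over values. -/
structure Attacker (S : Type) where
  init : S
  step : S → Val → S

/-- The attacker's state after observing trace `t`. -/
def Attacker.run {S : Type} (A : Attacker S) (t : List Val) : S :=
  t.foldl A.step A.init

/-- The counting variant `A^ω` of an attacker. -/
def Attacker.omega {S : Type} (A : Attacker S) : Attacker (S × ℕ) where
  init := (A.init, 0)
  step := fun sn v => (A.step sn.1 v, sn.2 + 1)

/-- Attacker knowledge `k(A,c,a,t)`. -/
def know {S : Type} (A : Attacker S) (c : Cmd) (a : Chan) (t : List Val) : Set Store :=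
  { ρ | ∃ t', Produces c ρ a t' ∧ A.run t' = A.run t }

/-- Exclusion knowledge `ek(A,c,a,t)`. -/
def ek {S : Type} (A : Attacker S) (c : Cmd) (a : Chan) (t : List Val) : Set Store :=
  (know A c a t)ᶜ

/-- Full progress knowledge `k#(A,c,a,t)`. -/
def kSharp {S : Type} (A : Attacker S) (c : Cmd) (a : Chan) (t : List Val) : Set Store :=
  { ρ | ∃ t' v, Produces c ρ a (t' ++ [v]) ∧ A.omega.run t' = A.omega.run t }

/-- Exclusion version `ek#(A,c,a,t)`. -/
def ekSharp {S : Type} (A : Attacker S) (c : Cmd) (a : Chan) (t : List Val) : Set Store :=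
  (kSharp A c a t)ᶜ

/-- AC progress knowledge `k⁺(A,c,a,t)`. -/
def kPlus {S : Type} (A : Attacker S) (c : Cmd) (a : Chan) (t : List Val) : Set Store :=
  { ρ | ∃ t' v, Produces c ρ a (t' ++ [v]) ∧ A.run t' = A.run t }

/-- Exclusion version `ek⁺(A,c,a,t)`. -/
def ekPlus {S : Type} (A : Attacker S) (c : Cmd) (a : Chan) (t : List Val) : Set Store :=
  (kPlus A c a t)ᶜ

/-- A dynamic policy: an equivalence relation on stores per channel and execution point. -/
structure DynPolicy where
  rel : Chan → Cmd → Store → ℕ → Store → Store → Prop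
  isEquiv : ∀ a c σ n, Equivalence (rel a c σ n)

/-- Progress-insensitive security of `c` for policy `D` against attacker `A`
on channel `a` for initial store `σ`. -/
def PISecure {S : Type} (c : Cmd) (D : DynPolicy) (A : Attacker S) (a : Chan) (σ : Store) : Prop :=
  ∀ t n c' σ' v, ProjSteps (c, σ) a t n (c', σ') →
    (∃ cfg', ProjSteps (c', σ') a [v] 1 cfg') →
    ek A c a (t ++ [v]) \ ekSharp A c a t ⊆ { ρ | ¬ D.rel a c σ n ρ σ }

/-- AC progress-insensitive security of `c` for policy `D` against attacker `A`
on channel `a` for initial store `σ`. -/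
def ACPISecure {S : Type} (c : Cmd) (D : DynPolicy) (A : Attacker S) (a : Chan) (σ : Store) : Prop :=
  ∀ t n c' σ' v, ProjSteps (c, σ) a t n (c', σ') →
    (∃ cfg', ProjSteps (c', σ') a [v] 1 cfg') →
    ek A c a (t ++ [v]) \ ekPlus A c a t ⊆ { ρ | ¬ D.rel a c σ n ρ σ }

/-- Two-run progress-insensitive security. -/
def TwoRunPISecure (c : Cmd) (D : DynPolicy) (a : Chan) (σ : Store) : Prop :=
  ∀ t n cn σn v, ProjSteps (c, σ) a t n (cn, σn) →
    (∃ cfg', ProjSteps (cn, σn) a [v] 1 cfg') →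
    ∀ ρ t' v', D.rel a c σ n ρ σ → Produces c ρ a (t' ++ [v']) → t'.length = t.length →
      v' = v

/-- A counting attacker always remembers at least how many outputs it has seen. -/
def Attacker.Counting {S : Type} (A : Attacker S) : Prop :=
  ∀ t t' : List Val, A.run t = A.run t' → t.length = t'.length

/-- A command is quasi-constant if, per channel, all its traces are prefixes of
one fixed (possibly infinite) trace. -/
def QuasiConstant (c : Cmd) : Prop :=
  ∀ a : Chan, ∃ u : ℕ → Val, ∀ σ t, Produces c σ a t →
    ∀ i : Fin t.length, t.get i = u i.val

/-- The variables of the dependency type system. -/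
inductive TVar where
  | pvar : PVar → TVar
  | cpoint : Chan → PPoint → TVar
  | pc : TVar
  | chan : Chan → TVar
deriving DecidableEq

/-- Type environments. -/
abbrev Env := TVar → Set TVar

/-- The identity environment. -/
def idEnv : Env := fun x => {x}

/-- Sequential composition of environments: `(Γ₂;Γ₁)(x) = ⋃_{y ∈ Γ₂(x)} Γ₁(y)`. -/
def envComp (Γ₂ Γ₁ : Env) : Env := fun x => ⋃ y ∈ Γ₂ x, Γ₁ y

/-- Pointwise union of environments. -/
def envUnion (Γ₁ Γ₂ : Env) : Env := fun x => Γ₁ x ∪ Γ₂ x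

/-- Iterates of an environment. -/
def envIter (Γ : Env) : ℕ → Env
  | 0 => idEnv
  | n+1 => envComp (envIter Γ n) Γ

/-- The fixed point `Γ* = ⋃_{n≥0} Γⁿ`. -/
def envStar (Γ : Env) : Env := fun x => ⋃ n, envIter Γ n x

/-- Free variables of an expression, as type-system variables. -/
def fvT (e : Expr) : Set TVar := TVar.pvar '' e.fv

/-- The dependency type system `⊢{c}Γ`. -/
inductive Typing : Cmd → Env → Prop where
  | skip : Typing .skip idEnv
  | assign : ∀ (x : PVar) (e : Expr),
      Typing (.assign x e) (Function.update idEnv (.pvar x) (fvT e ∪ {TVar.pc}))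
  | seq : ∀ {c₁ : Cmd} {Γ₁ : Env} {c₂ : Cmd} {Γ₂ : Env},
      Typing c₁ Γ₁ → Typing c₂ Γ₂ → Typing (.seq c₁ c₂) (envComp Γ₂ Γ₁)
  | ite : ∀ {e : Expr} {c₁ : Cmd} {Γ₁ : Env} {c₂ : Cmd} {Γ₂ : Env},
      Typing c₁ Γ₁ → Typing c₂ Γ₂ →
      Typing (.ite e c₁ c₂)
        (Function.update
          (envUnion (envComp Γ₁ (Function.update idEnv .pc ({TVar.pc} ∪ fvT e)))
                    (envComp Γ₂ (Function.update idEnv .pc ({TVar.pc} ∪ fvT e))))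
          .pc {TVar.pc})
  | whileT : ∀ {e : Expr} {c : Cmd} {Γc : Env}, Typing c Γc →
      Typing (.while e c)
        (Function.update
          (envStar (envComp Γc (Function.update idEnv .pc ({TVar.pc} ∪ fvT e))))
          .pc {TVar.pc})
  | out : ∀ (e : Expr) (a : Chan) (p : PPoint),
      Typing (.out e a p)
        (Function.update
          (Function.update idEnv (.cpoint a p)
            (fvT e ∪ {TVar.pc, TVar.chan a, TVar.cpoint a p}))
          (.chan a) {TVar.pc, TVar.chan a})

/-- `σ ≡_{Γ(x)} ρ`: the stores agree on all program variables in `Γ(x)`. -/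
def eqG (Γ : Env) (x : TVar) (σ ρ : Store) : Prop :=
  ∀ y : PVar, TVar.pvar y ∈ Γ x → σ y = ρ y

/-- A dynamic policy approximation: an equivalence relation on stores per
channel–program-point pair. -/
structure PolApprox where
  rel : Chan → PPoint → Store → Store → Prop
  isEquiv : ∀ a p, Equivalence (rel a p)

/-- `c : A` is a sound approximation of dynamic policy `D`. -/
def SoundApprox (c : Cmd) (A : PolApprox) (D : DynPolicy) : Prop :=
  ∀ σ n ls c' σ' a v p cfg'',
    Steps (c, σ) ls n (c', σ') → Step (c', σ') (.out a v p) cfg'' →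
    ∀ ρ₁ ρ₂, D.rel a c σ n ρ₁ ρ₂ → A.rel a p ρ₁ ρ₂

/-- Big-step states: a store and the number of outputs so far on the observed channel. -/
abbrev BSt := Store × ℕ

/-- Big-step results: termination, or stopping at an output on the observed channel. -/
inductive BRes where
  | done : BSt → BRes
  | hit : PPoint → Val → ℕ → BRes

def bumpCount (a b : Chan) (k : ℕ) : ℕ := if b = a then k + 1 else k

/-- Big-step prefix semantics with respect to a channel `a`. -/
inductive BS (a : Chan) : Cmd → BSt → BRes → Prop where
  | skip : ∀ s, BS a .skip s (.done s)
  | assign : ∀ x e (s : BSt), BS a (.assign x e) s (.done (Function.update s.1 x (e.eval s.1), s.2))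
  | outDone : ∀ e b p (s : BSt), BS a (.out e b p) s (.done (s.1, bumpCount a b s.2))
  | outHit : ∀ e p (s : BSt), BS a (.out e a p) s (.hit p (e.eval s.1) s.2)
  | seqHit : ∀ {c₁ s p v k} c₂, BS a c₁ s (.hit p v k) → BS a (.seq c₁ c₂) s (.hit p v k)
  | seqDone : ∀ {c₁ c₂ s m r}, BS a c₁ s (.done m) → BS a c₂ m r → BS a (.seq c₁ c₂) s r
  | iteT : ∀ {e c₁ s r} c₂, e.eval s.1 ≠ 0 → BS a c₁ s r → BS a (.ite e c₁ c₂) s r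
  | iteF : ∀ {e c₂ s r} c₁, e.eval s.1 = 0 → BS a c₂ s r → BS a (.ite e c₁ c₂) s r
  | whF : ∀ {e s} c, e.eval s.1 = 0 → BS a (.while e c) s (.done s)
  | whHit : ∀ {e c s p v k}, e.eval s.1 ≠ 0 → BS a c s (.hit p v k) →
      BS a (.while e c) s (.hit p v k)
  | whLoop : ∀ {e c s m r}, e.eval s.1 ≠ 0 → BS a c s (.done m) →
      BS a (.while e c) m r → BS a (.while e c) s r

theorem BS.while_ind {a : Chan} {e : Expr} {c : Cmd} {P : BSt → BRes → Prop}
    (hF : ∀ s : BSt, e.eval s.1 = 0 → P s (.done s))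
    (hH : ∀ (s : BSt) p v k, e.eval s.1 ≠ 0 → BS a c s (.hit p v k) → P s (.hit p v k))
    (hL : ∀ (s m : BSt) r, e.eval s.1 ≠ 0 → BS a c s (.done m) →
      BS a (.while e c) m r → P m r → P s r)
    {s : BSt} {r : BRes} (h : BS a (.while e c) s r) : P s r := by
  generalize hw : Cmd.while e c = w at h
  induction h with
  | whF c h => cases hw; exact hF _ h
  | whHit h h1 => cases hw; exact hH _ _ _ _ h h1
  | whLoop h h1 h2 _ ih => cases hw; exact hL _ _ _ h h1 h2 (ih rfl)
  | _ => cases hw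

def BRes.cnt : BRes → ℕ
  | .done s => s.2
  | .hit _ _ k => k

theorem BS.mono {a : Chan} {c : Cmd} {s : BSt} {r : BRes} (h : BS a c s r) : s.2 ≤ r.cnt := by
  induction h with
  | outDone => simp only [BRes.cnt, bumpCount]; split <;> omega
  | _ => simp_all [BRes.cnt] <;> omega

/-- Count contributed by a label. -/
def lblCount (a : Chan) (α : Label) (k : ℕ) : ℕ :=
  match α with
  | .silent => k
  | .out b _ _ => bumpCount a b k

theorem Step.hit_bs {a : Chan} {v : Val} {p : PPoint} {cfg cfg' : Config} {α : Label}
    (h : Step cfg α cfg') : α = .out a v p → ∀ k, BS a cfg.1 (cfg.2, k) (.hit p v k) := by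
  induction h with
  | seq c₂ h ih => intro hα k; exact BS.seqHit _ (ih hα k)
  | out e b q σ => intro hα k; cases hα; exact BS.outHit e p (σ, k)
  | _ => intro hα; cases hα

theorem Step.expand_bs {a : Chan} {cfg cfg' : Config} {α : Label}
    (h : Step cfg α cfg') : ∀ k r, BS a cfg'.1 (cfg'.2, lblCount a α k) r →
      BS a cfg.1 (cfg.2, k) r := by
  induction h with
  | skipSeq c σ => intro k r h; exact BS.seqDone (BS.skip _) h
  | seq c₂ h ih =>
    intro k r h
    cases h with
    | seqHit _ h => exact BS.seqHit _ (ih _ _ h)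
    | seqDone h h' => exact BS.seqDone (ih _ _ h) h'
  | assign x e σ => intro k r h; cases h; exact BS.assign x e (σ, k)
  | out e b q σ => intro k r h; cases h; exact BS.outDone e b q (σ, k)
  | whileStep e c σ =>
    intro k r h
    cases h with
    | iteT _ he h =>
      cases h with
      | seqHit _ h => exact BS.whHit he h
      | seqDone h h' => exact BS.whLoop he h h'
    | iteF _ he h => cases h; exact BS.whF _ he
  | iteTrue c₁ c₂ he => intro k r h; exact BS.iteT _ he h
  | iteFalse c₁ c₂ he => intro k r h; exact BS.iteF _ he h

theorem projA_consTo_silent (a : Chan) (ls : List Label) :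
    projA a (Label.consTo .silent ls) = projA a ls := rfl

theorem projA_consTo_out (a b : Chan) (v : Val) (p : PPoint) (ls : List Label) :
    projA a (Label.consTo (.out b v p) ls) = if b = a then v :: projA a ls else projA a ls := by
  simp only [Label.consTo, projA, List.filterMap_cons]
  split <;> split at * <;> simp_all

theorem Steps.hit_bs {a : Chan} {v : Val} {p : PPoint} {cfg cfg' : Config} {ls : List Label} {n : ℕ}
    (h : Steps cfg ls n cfg') : ∀ {cfg'' : Config}, Step cfg' (.out a v p) cfg'' →
    ∀ k, BS a cfg.1 (cfg.2, k) (.hit p v (k + (projA a ls).length)) := by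
  induction h with
  | refl => intro _ h k; exact h.hit_bs rfl k
  | @step _ α _ ls n _ h _ ih =>
    intro _ h' k
    apply h.expand_bs
    have := ih h' (lblCount a α k)
    convert this using 2
    cases α with
    | silent => rfl
    | out b w q =>
      rw [projA_consTo_out]
      simp only [lblCount, bumpCount]
      split <;> simp <;> omega

theorem Steps.split_last {a : Chan} {v : Val} {cfg cfg' : Config} {ls : List Label} {n : ℕ}
    (h : Steps cfg ls n cfg') : ∀ {t : List Val}, projA a ls = t ++ [v] →
    ∃ ls₁ n₁ cfg₁ p cfg₂, Steps cfg ls₁ n₁ cfg₁ ∧ projA a ls₁ = t ∧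
      Step cfg₁ (.out a v p) cfg₂ := by
  induction h with
  | refl => intro t h; simp [projA] at h
  | @step cfg α _ ls n _ h _ ih =>
    intro t ht
    cases α with
    | silent =>
      obtain ⟨ls₁, n₁, c1, p, c2, h1, h2, h3⟩ := ih ht
      exact ⟨_, _, c1, p, c2, Steps.step h h1, h2, h3⟩
    | out b w q =>
      rw [projA_consTo_out] at ht
      split at ht
      · rename_i hb
        subst hb
        cases t with
        | nil =>
          simp at ht
          obtain ⟨rfl, _⟩ := ht
          exact ⟨_, _, cfg, q, _, Steps.refl _, rfl, h⟩
        | cons u t =>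
          simp at ht
          obtain ⟨rfl, ht⟩ := ht
          obtain ⟨ls₁, n₁, c1, p, c2, h1, h2, h3⟩ := ih ht
          refine ⟨_, _, c1, p, c2, Steps.step h h1, ?_, h3⟩
          rw [projA_consTo_out, h2]; simp
      · rename_i hb
        obtain ⟨ls₁, n₁, c1, p, c2, h1, h2, h3⟩ := ih ht
        refine ⟨_, _, c1, p, c2, Steps.step h h1, ?_, h3⟩
        rw [projA_consTo_out, if_neg hb, h2]

/-- Value of a typing variable in a big-step state. -/
def tval (a : Chan) : TVar → BSt → ℤ
  | .pvar y, s => s.1 y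
  | .chan b, s => if b = a then (s.2 : ℤ) else 0
  | _, _ => 0

def Agree (a : Chan) (S : Set TVar) (s₁ s₂ : BSt) : Prop := ∀ y ∈ S, tval a y s₁ = tval a y s₂

theorem Agree.mono {a : Chan} {S T : Set TVar} {s₁ s₂ : BSt} (h : Agree a T s₁ s₂) (hs : S ⊆ T) :
    Agree a S s₁ s₂ := fun y hy => h y (hs hy)

theorem Agree.symm {a : Chan} {S : Set TVar} {s₁ s₂ : BSt} (h : Agree a S s₁ s₂) :
    Agree a S s₂ s₁ := fun y hy => (h y hy).symm

theorem Agree.eval {a : Chan} {S : Set TVar} {s₁ s₂ : BSt} {e : Expr} (h : Agree a S s₁ s₂)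
    (hs : fvT e ⊆ S) : e.eval s₁.1 = e.eval s₂.1 := by
  cases e with
  | const v => rfl
  | var x => exact h (.pvar x) (hs ⟨x, rfl, rfl⟩)

def Good (a : Chan) (x : TVar) : BRes → BRes → Prop
  | .done s₁, .done s₂ => tval a x s₁ = tval a x s₂
  | .hit p v k, .hit q w l => (x = .cpoint a p ∨ x = .cpoint a q) → k = l → v = w
  | .hit p _ k, .done s => (x = .cpoint a p ∨ x = .chan a) → k < s.2
  | .done s, .hit p _ k => (x = .cpoint a p ∨ x = .chan a) → k < s.2

theorem Good.symm {a : Chan} {x : TVar} {r₁ r₂ : BRes} (h : Good a x r₁ r₂) : Good a x r₂ r₁ := by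
  cases r₁ <;> cases r₂ <;> simp only [Good] at * <;> grind

theorem Good.pc {a : Chan} (r₁ r₂ : BRes) : Good a .pc r₁ r₂ := by
  cases r₁ <;> cases r₂ <;> simp [Good, tval]

def Unt (a : Chan) (x : TVar) (s : BSt) : BRes → Prop
  | .done s' => tval a x s' = tval a x s
  | .hit p _ _ => x ≠ .cpoint a p ∧ x ≠ .chan a

theorem Good.of_unt {a : Chan} {x : TVar} {s₁ s₂ : BSt} {r₁ r₂ : BRes} (h : tval a x s₁ = tval a x s₂)
    (h₁ : Unt a x s₁ r₁) (h₂ : Unt a x s₂ r₂) : Good a x r₁ r₂ := by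
  cases r₁ <;> cases r₂ <;> simp only [Good, Unt] at * <;> grind

theorem mem_envComp {Γ₂ Γ₁ : Env} {x z : TVar} : z ∈ envComp Γ₂ Γ₁ x ↔ ∃ y ∈ Γ₂ x, z ∈ Γ₁ y := by
  simp [envComp]

theorem sub_envComp {Γ₂ Γ₁ : Env} {x y : TVar} (h : y ∈ Γ₂ x) : Γ₁ y ⊆ envComp Γ₂ Γ₁ x :=
  fun _ hz => mem_envComp.2 ⟨y, h, hz⟩

abbrev pcEnv (e : Expr) : Env := Function.update idEnv .pc ({TVar.pc} ∪ fvT e)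

theorem self_pcEnv (e : Expr) (y : TVar) : y ∈ pcEnv e y := by
  by_cases h : y = .pc
  · subst h; simp [pcEnv]
  · simp [pcEnv, Function.update_of_ne h, idEnv]

theorem sub_pcComp (Γ : Env) (e : Expr) (x : TVar) : Γ x ⊆ envComp Γ (pcEnv e) x :=
  fun y hy => mem_envComp.2 ⟨y, hy, self_pcEnv e y⟩

theorem fv_pcComp {Γ : Env} {e : Expr} {x : TVar} (h : TVar.pc ∈ Γ x) :
    fvT e ⊆ envComp Γ (pcEnv e) x :=
  fun y hy => mem_envComp.2 ⟨_, h, by simp [pcEnv, hy]⟩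

theorem self_star (G : Env) (x : TVar) : x ∈ envStar G x :=
  Set.mem_iUnion.2 ⟨0, rfl⟩

theorem sub_star {G : Env} {x y : TVar} (h : y ∈ envStar G x) : G y ⊆ envStar G x := by
  obtain ⟨n, hn⟩ := Set.mem_iUnion.1 h
  exact fun z hz => Set.mem_iUnion.2 ⟨n + 1, sub_envComp hn hz⟩

structure Shape (Γ : Env) : Prop where
  pc : TVar.pc ∈ Γ .pc
  chan : ∀ a, TVar.chan a ∈ Γ (.chan a)
  cpoint : ∀ a p, TVar.cpoint a p ∈ Γ (.cpoint a p)
  self : ∀ x, TVar.pc ∉ Γ x → x ∈ Γ x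

theorem Typing.shape {c : Cmd} {Γ : Env} (h : Typing c Γ) : Shape Γ := by
  induction h with
  | skip => constructor <;> simp [idEnv]
  | assign x e =>
    refine ⟨by simp [idEnv], by simp [idEnv], by simp [idEnv], ?_⟩
    intro y hy
    by_cases h : y = .pvar x
    · subst h; simp at hy
    · simp [Function.update_of_ne h, idEnv]
  | seq _ _ h₁ h₂ =>
    refine ⟨sub_envComp h₂.pc h₁.pc, fun a => sub_envComp (h₂.chan a) (h₁.chan a),
      fun a p => sub_envComp (h₂.cpoint a p) (h₁.cpoint a p), ?_⟩
    intro x hx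
    have h2 : TVar.pc ∉ _ := fun h => hx (sub_envComp h h₁.pc)
    have h3 := h₂.self x h2
    exact sub_envComp h3 (h₁.self x fun h => hx (sub_envComp h3 h))
  | @ite e c₁ Γ₁ c₂ Γ₂ _ _ h₁ h₂ =>
    refine ⟨by simp, fun a => ?_, fun a p => ?_, ?_⟩
    · rw [Function.update_of_ne (by simp)]; exact Or.inl (sub_pcComp _ _ _ (h₁.chan a))
    · rw [Function.update_of_ne (by simp)]; exact Or.inl (sub_pcComp _ _ _ (h₁.cpoint a p))
    · intro x hx
      by_cases h : x = .pc
      · subst h; simp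
      rw [Function.update_of_ne h] at *
      exact Or.inl (sub_pcComp _ _ _ (h₁.self x fun h => hx (Or.inl (sub_pcComp _ _ _ h))))
  | @whileT e c Γc _ ih =>
    refine ⟨by simp, fun a => ?_, fun a p => ?_, ?_⟩
    · rw [Function.update_of_ne (by simp)]; exact self_star _ _
    · rw [Function.update_of_ne (by simp)]; exact self_star _ _
    · intro x hx
      by_cases h : x = .pc
      · subst h; simp
      rw [Function.update_of_ne h]; exact self_star _ _
  | out e a p =>
    refine ⟨by simp [idEnv], fun b => ?_, fun b q => ?_, ?_⟩
    · by_cases h : b = a <;> simp [h, idEnv]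
    · rw [Function.update_of_ne (by simp)]
      by_cases h : TVar.cpoint b q = .cpoint a p
      · rw [h]; simp
      · rw [Function.update_of_ne h]; rfl
    · intro y hy
      by_cases h : y = .chan a
      · subst h; simp
      rw [Function.update_of_ne h]
      by_cases h : y = .cpoint a p
      · subst h; simp
      · rw [Function.update_of_ne h]; rfl

theorem Unt.trans {a : Chan} {x : TVar} {s m : BSt} {r : BRes}
    (h₁ : Unt a x s (.done m)) (h₂ : Unt a x m r) : Unt a x s r := by
  cases r <;> simp_all [Unt]

theorem Typing.unt {a : Chan} {c : Cmd} {Γ : Env} (h : Typing c Γ) :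
    ∀ x, TVar.pc ∉ Γ x → ∀ s r, BS a c s r → Unt a x s r := by
  induction h with
  | skip => intro x hx s r h; cases h; rfl
  | assign x e =>
    intro y hy s r h
    cases h
    have hne : y ≠ .pvar x := by rintro rfl; simp at hy
    cases y <;> simp_all [Unt, tval, Function.update_apply]
  | seq t₁ t₂ h₁ h₂ =>
    intro x hx s r h
    have h2 : TVar.pc ∉ _ := fun h => hx (sub_envComp h t₁.shape.pc)
    have h3 := t₂.shape.self x h2
    have h1 : TVar.pc ∉ _ := fun h => hx (sub_envComp h3 h)
    cases h with
    | seqHit _ h => exact h₁ x h1 _ _ h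
    | seqDone h h' => exact (h₁ x h1 _ _ h).trans (h₂ x h2 _ _ h')
  | ite t₁ t₂ h₁ h₂ =>
    intro x hx s r h
    have hne : x ≠ .pc := by rintro rfl; simp at hx
    rw [Function.update_of_ne hne] at hx
    cases h with
    | iteT _ _ h => exact h₁ x (fun h => hx (Or.inl (sub_pcComp _ _ _ h))) _ _ h
    | iteF _ _ h => exact h₂ x (fun h => hx (Or.inr (sub_pcComp _ _ _ h))) _ _ h
  | whileT t ih =>
    intro x hx s r h
    have hne : x ≠ .pc := by rintro rfl; simp at hx
    rw [Function.update_of_ne hne] at hx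
    have hc : TVar.pc ∉ _ := fun h => hx (sub_star (self_star _ _) (sub_pcComp _ _ _ h))
    refine BS.while_ind (P := fun s r => Unt a x s r) ?_ ?_ ?_ h
    · intro s _; rfl
    · intro s p v k _ h; exact ih x hc _ _ h
    · intro s m r _ h _ h'; exact (ih x hc _ _ h).trans h'
  | out e b p =>
    intro x hx s r h
    have h1 : x ≠ .chan b := by rintro rfl; simp at hx
    have h2 : x ≠ .cpoint b p := by rintro rfl; simp at hx
    cases h with
    | outDone =>
      cases x <;> simp only [Unt, tval]
      rename_i b'
      split
      · subst_vars
        have : b ≠ b' := by rintro rfl; exact h1 rfl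
        simp [bumpCount, this]
      · rfl
    | outHit => exact ⟨h2, h1⟩

theorem Typing.hit_chan {a : Chan} {c : Cmd} {Γ : Env} (h : Typing c Γ) :
    ∀ s p v k, BS a c s (.hit p v k) → TVar.chan a ∈ Γ (.cpoint a p) := by
  induction h with
  | skip => intro s p v k h; cases h
  | assign x e => intro s p v k h; cases h
  | seq t₁ t₂ h₁ h₂ =>
    intro s p v k h
    cases h with
    | seqHit _ h => exact sub_envComp (t₂.shape.cpoint a p) (h₁ _ _ _ _ h)
    | seqDone h h' => exact sub_envComp (h₂ _ _ _ _ h') (t₁.shape.chan a)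
  | ite t₁ t₂ h₁ h₂ =>
    intro s p v k h
    rw [Function.update_of_ne (by simp)]
    cases h with
    | iteT _ _ h => exact Or.inl (sub_pcComp _ _ _ (h₁ _ _ _ _ h))
    | iteF _ _ h => exact Or.inr (sub_pcComp _ _ _ (h₂ _ _ _ _ h))
  | @whileT e c Γc t ih =>
    intro s p v k h
    rw [Function.update_of_ne (by simp)]
    have := BS.while_ind (P := fun s r => ∀ p v k, r = .hit p v k →
      TVar.chan a ∈ envStar (envComp Γc (pcEnv e)) (.cpoint a p)) ?_ ?_ ?_ h
    · exact this _ _ _ rfl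
    · intro s _ p v k h; cases h
    · intro s p v k _ h p v k h'; cases h'
      exact sub_star (self_star _ _) (sub_pcComp _ _ _ (ih _ _ _ _ h))
    · intro s m r _ _ _ h; exact h
  | out e b p =>
    intro s q v k h
    cases h
    simp

theorem Good.mix {a : Chan} {x : TVar} {S : Set TVar} {m : BSt} {q : PPoint} {w : Val} {l : ℕ}
    {r : BRes} (hc : x = .chan a → x ∈ S) (hp : ∀ p, x = .cpoint a p → x ∈ S)
    (hr : m.2 ≤ r.cnt) (hch : ∀ p v k, r = .hit p v k → x = .cpoint a p → TVar.chan a ∈ S)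
    (G : ∀ y ∈ S, Good a y (.done m) (.hit q w l)) : Good a x r (.hit q w l) := by
  cases r with
  | done s =>
    simp only [Good, BRes.cnt] at *
    intro h
    have hx : x ∈ S := by rcases h with h | h; exacts [hp _ h, hc h]
    have := G x hx h
    omega
  | hit p v k =>
    simp only [Good, BRes.cnt] at *
    rintro (h | h) rfl
    · have := G _ (hch _ _ _ rfl h) (Or.inr rfl); omega
    · have := G x (hp _ h) (Or.inl h); omega

theorem Good.hit_of {a : Chan} {x : TVar} {S : Set TVar} {p q : PPoint} {v w : Val} {k l : ℕ}
    (hp : ∀ p, x = .cpoint a p → x ∈ S)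
    (G : ∀ y ∈ S, Good a y (.hit p v k) (.hit q w l)) : Good a x (.hit p v k) (.hit q w l) := by
  intro h
  rcases h with h | h
  · exact G x (hp _ h) (Or.inl h)
  · exact G x (hp _ h) (Or.inr h)

theorem Typing.good {a : Chan} {c : Cmd} {Γ : Env} (h : Typing c Γ) :
    ∀ x s₁ s₂ r₁ r₂, Agree a (Γ x) s₁ s₂ → BS a c s₁ r₁ → BS a c s₂ r₂ → Good a x r₁ r₂ := by
  induction h with
  | skip =>
    intro x s₁ s₂ r₁ r₂ hA h₁ h₂
    cases h₁; cases h₂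
    exact hA x rfl
  | assign y e =>
    intro x s₁ s₂ r₁ r₂ hA h₁ h₂
    cases h₁; cases h₂
    by_cases h : x = .pvar y
    · subst h
      have := hA.eval (e := e) (by simp)
      simpa [Good, tval] using this
    · rw [Function.update_of_ne h] at hA
      have := hA x rfl
      cases x <;> simp_all [Good, tval, Function.update_apply]
  | @seq c₁ Γ₁ c₂ Γ₂ t₁ t₂ ih₁ ih₂ =>
    intro x s₁ s₂ r₁ r₂ hA h₁ h₂
    have hA' : ∀ y ∈ Γ₂ x, Agree a (Γ₁ y) s₁ s₂ := fun y hy => hA.mono (sub_envComp hy)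
    have hc : x = .chan a → x ∈ Γ₂ x := by rintro rfl; exact t₂.shape.chan a
    have hp : ∀ p, x = .cpoint a p → x ∈ Γ₂ x := by rintro p rfl; exact t₂.shape.cpoint a p
    cases h₁ with
    | seqHit _ h₁ =>
      cases h₂ with
      | seqHit _ h₂ => exact Good.hit_of hp fun y hy => ih₁ y _ _ _ _ (hA' y hy) h₁ h₂
      | seqDone h₂ h₂' =>
        refine (Good.mix hc hp h₂'.mono ?_ fun y hy => (ih₁ y _ _ _ _ (hA' y hy) h₁ h₂).symm).symm
        rintro p v k rfl rfl; exact t₂.hit_chan _ _ _ _ h₂'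
    | seqDone h₁ h₁' =>
      cases h₂ with
      | seqHit _ h₂ =>
        refine Good.mix hc hp h₁'.mono ?_ fun y hy => ih₁ y _ _ _ _ (hA' y hy) h₁ h₂
        rintro p v k rfl rfl; exact t₂.hit_chan _ _ _ _ h₁'
      | seqDone h₂ h₂' =>
        exact ih₂ x _ _ _ _ (fun y hy => ih₁ y _ _ _ _ (hA' y hy) h₁ h₂) h₁' h₂'
  | @ite e c₁ Γ₁ c₂ Γ₂ t₁ t₂ ih₁ ih₂ =>
    intro x s₁ s₂ r₁ r₂ hA h₁ h₂
    by_cases hne : x = .pc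
    · subst hne; exact Good.pc _ _
    rw [Function.update_of_ne hne] at hA
    have hA₁ : Agree a (Γ₁ x) s₁ s₂ := hA.mono fun y hy => Or.inl (sub_pcComp _ _ _ hy)
    have hA₂ : Agree a (Γ₂ x) s₁ s₂ := hA.mono fun y hy => Or.inr (sub_pcComp _ _ _ hy)
    have key : e.eval s₁.1 = e.eval s₂.1 ∨ (TVar.pc ∉ Γ₁ x ∧ TVar.pc ∉ Γ₂ x) := by
      by_cases h1 : TVar.pc ∈ Γ₁ x
      · exact Or.inl (hA.eval fun y hy => Or.inl (fv_pcComp h1 hy))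
      by_cases h2 : TVar.pc ∈ Γ₂ x
      · exact Or.inl (hA.eval fun y hy => Or.inr (fv_pcComp h2 hy))
      exact Or.inr ⟨h1, h2⟩
    rcases key with key | ⟨n1, n2⟩
    · cases h₁ with
      | iteT _ he h₁ =>
        cases h₂ with
        | iteT _ he' h₂ => exact ih₁ x _ _ _ _ hA₁ h₁ h₂
        | iteF _ he' h₂ => exact absurd (key.trans he') he
      | iteF _ he h₁ =>
        cases h₂ with
        | iteT _ he' h₂ => exact absurd (key.symm.trans he) he'
        | iteF _ he' h₂ => exact ih₂ x _ _ _ _ hA₂ h₁ h₂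
    · refine Good.of_unt (hA₁ x (t₁.shape.self x n1)) ?_ ?_
      · cases h₁ with
        | iteT _ _ h => exact t₁.unt x n1 _ _ h
        | iteF _ _ h => exact t₂.unt x n2 _ _ h
      · cases h₂ with
        | iteT _ _ h => exact t₁.unt x n1 _ _ h
        | iteF _ _ h => exact t₂.unt x n2 _ _ h
  | @whileT e c Γc t ih =>
    intro x s₁ s₂ r₁ r₂ hA h₁ h₂
    by_cases hne : x = .pc
    · subst hne; exact Good.pc _ _
    rw [Function.update_of_ne hne] at hA
    change Agree a (envStar (envComp Γc (pcEnv e)) x) s₁ s₂ at hA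
    have hself : x ∈ envStar (envComp Γc (pcEnv e)) x := self_star _ _
    have hc : x = .chan a → x ∈ envStar (envComp Γc (pcEnv e)) x := fun _ => hself
    have hp : ∀ p, x = .cpoint a p → x ∈ envStar (envComp Γc (pcEnv e)) x := fun _ _ => hself
    have hch : ∀ s r, BS a (.while e c) s r → ∀ p v k, r = .hit p v k → x = .cpoint a p →
        TVar.chan a ∈ envStar (envComp Γc (pcEnv e)) x := by
      rintro s r h p v k rfl rfl
      have := (Typing.whileT (e := e) t).hit_chan _ _ _ _ h
      rwa [Function.update_of_ne (by simp)] at this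
    have hbody : ∀ s s', Agree a (envStar (envComp Γc (pcEnv e)) x) s s' →
        ∀ y ∈ envStar (envComp Γc (pcEnv e)) x, Agree a (Γc y) s s' := fun s s' h y hy =>
      h.mono fun z hz => sub_star hy (sub_pcComp _ _ _ hz)
    by_cases hpc : TVar.pc ∈ envStar (envComp Γc (pcEnv e)) x
    swap
    · have hu := (Typing.whileT (e := e) t).unt (a := a) x
        (by rw [Function.update_of_ne hne]; exact hpc)
      exact Good.of_unt (hA x hself) (hu _ _ h₁) (hu _ _ h₂)
    by_cases hpc' : TVar.pc ∈ Γc x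
    swap
    · have hu : ∀ s r, BS a (.while e c) s r → Unt a x s r := by
        intro s r h
        refine BS.while_ind (P := fun s r => Unt a x s r) ?_ ?_ ?_ h
        · intro s _; rfl
        · intro s p v k _ h; exact t.unt x hpc' _ _ h
        · intro s m r _ h _ h'; exact (t.unt x hpc' _ _ h).trans h'
      exact Good.of_unt (hA x hself) (hu _ _ h₁) (hu _ _ h₂)
    have hfv : fvT e ⊆ envStar (envComp Γc (pcEnv e)) x :=
      fun y hy => sub_star hself (fv_pcComp hpc' hy)
    revert h₂
    revert hA
    refine BS.while_ind (P := fun s₁ r₁ => ∀ s₂ r₂,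
      Agree a (envStar (envComp Γc (pcEnv e)) x) s₁ s₂ →
      BS a (.while e c) s₂ r₂ → Good a x r₁ r₂) ?_ ?_ ?_ h₁ s₂ r₂
    · intro s₁ he s₂ r₂ hA h₂
      have key := hA.eval hfv
      cases h₂ with
      | whF => exact hA x hself
      | whHit he' => exact absurd (key.symm.trans he) he'
      | whLoop he' => exact absurd (key.symm.trans he) he'
    · intro s₁ p v k he h₁ s₂ r₂ hA h₂
      have key := hA.eval hfv
      cases h₂ with
      | whF _ he' => exact absurd (key.trans he') he
      | whHit _ h₂ => exact ih x _ _ _ _ (hbody _ _ hA x hself) h₁ h₂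
      | whLoop _ h₂ h₂' =>
        exact (Good.mix hc hp h₂'.mono (hch _ _ h₂')
          fun y hy => (ih y _ _ _ _ (hbody _ _ hA y hy) h₁ h₂).symm).symm
    · intro s₁ m₁ r₁ he h₁ h₁' IH s₂ r₂ hA h₂
      have key := hA.eval hfv
      cases h₂ with
      | whF _ he' => exact absurd (key.trans he') he
      | whHit _ h₂ =>
        exact Good.mix hc hp h₁'.mono (hch _ _ h₁')
          fun y hy => ih y _ _ _ _ (hbody _ _ hA y hy) h₁ h₂
      | whLoop _ h₂ h₂' =>
        exact IH _ _ (fun y hy => ih y _ _ _ _ (hbody _ _ hA y hy) h₁ h₂) h₂'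
  | out e b p =>
    intro x s₁ s₂ r₁ r₂ hA h₁ h₂
    by_cases hx : x = .chan b
    · subst hx
      have := hA (.chan b) (by simp)
      cases h₁ <;> cases h₂ <;> simp_all [Good, tval, bumpCount] <;> split_ifs at * <;> simp_all
    rw [Function.update_of_ne hx] at hA
    by_cases hx' : x = .cpoint b p
    · subst hx'
      have h1 := hA.eval (e := e) (by simp [Set.subset_def]; tauto)
      have h2 := hA (.chan b) (by simp)
      cases h₁ <;> cases h₂ <;> simp_all [Good, tval, bumpCount]
    rw [Function.update_of_ne hx'] at hA
    have := hA x rfl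
    cases h₁ <;> cases h₂ <;> simp_all [Good]
    cases x <;> simp_all [tval, bumpCount]
    grind

/-- PI dynamic policy compliance (two-run form). -/
theorem typing_twoRun_compliance {c : Cmd} {A : PolApprox} {D : DynPolicy} {Γ : Env}
    (hsound : SoundApprox c A D) (hty : Typing c Γ)
    (hcoarse : ∀ (a : Chan) (p : PPoint) (ρ₁ ρ₂ : Store),
      A.rel a p ρ₁ ρ₂ → eqG Γ (.cpoint a p) ρ₁ ρ₂) :
    ∀ (a : Chan) (σ : Store), TwoRunPISecure c D a σ := by
  rintro a σ t n cn σn v ⟨ls, hs, hproj⟩ ⟨cfg', ls', hs', hproj'⟩ ρ t' v' hD ⟨n', cfg2, ls2, hs2, hproj2⟩ hlen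
  have hstep : ∃ p, Step (cn, σn) (.out a v p) cfg' := by
    cases hs' with
    | @step _ α _ ls _ _ h h' =>
      cases h'
      cases α with
      | silent => rw [projA_consTo_silent] at hproj'; simp [projA] at hproj'
      | out b w q =>
        rw [projA_consTo_out] at hproj'
        split at hproj'
        · rename_i hb; subst hb
          simp [projA] at hproj'
          subst hproj'; exact ⟨q, h⟩
        · simp [projA] at hproj'
  obtain ⟨p, hstep⟩ := hstep
  obtain ⟨ls₁, n₁, cfg₁, q, cfg₂, g1, g2, g3⟩ := hs2.split_last hproj2
  have hA := hcoarse a p ρ σ (hsound σ n ls cn σn a v p cfg' hs hstep ρ σ hD)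
  have b1 := hs.hit_bs hstep 0
  have b2 := g1.hit_bs g3 0
  have hag : Agree a (Γ (.cpoint a p)) (ρ, 0) (σ, 0) := by
    intro y hy
    cases y with
    | pvar y => exact hA y hy
    | _ => rfl
  have := hty.good (.cpoint a p) _ _ _ _ hag b2 b1
  exact this (Or.inr rfl) (by rw [hproj, g2, hlen])
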